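/- Let u² and t be rational numbers with 0 < u² < t − 1 and let p and q be distinct primes. If v_p(u²) = −1 = v_q(u²), v_p(t) ≥ 0 and v_q(t) ≥ 0, then the image of the finite cusp set C(Δ(u²,2t)) under the diagonal embedding ℚ → ℚ_p × ℚ_q is not dense in ℚ_p × ℚ_q. -/

import Mathlib

open Matrix

/-- The projective general linear group `PGL₂(ℚ)`. -/
abbrev PGL2Q : Type := GL (Fin 2) ℚ ⧸ Subgroup.center (GL (Fin 2) ℚ)

/-- The canonical projection `GL₂(ℚ) → PGL₂(ℚ)`. -/
def pgl : GL (Fin 2) ℚ →* PGL2Q := QuotientGroup.mk' (Subgroup.center (GL (Fin 2) ℚ))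

/-- The Möbius action of a matrix `A ∈ GL₂(ℚ)` on `ℙ¹(ℚ) = ℚ ∪ {∞}`. -/
def moebius (A : GL (Fin 2) ℚ) (z : OnePoint ℚ) : OnePoint ℚ :=
  Option.elim z
    (if A.val 1 0 = 0 then OnePoint.infty else ((A.val 0 0 / A.val 1 0 : ℚ) : OnePoint ℚ))
    (fun x => if A.val 1 0 * x + A.val 1 1 = 0 then OnePoint.infty
      else (((A.val 0 0 * x + A.val 0 1) / (A.val 1 0 * x + A.val 1 1) : ℚ) : OnePoint ℚ))

/-- `Δ(u²,2t)`: the subgroup of `PGL₂(ℚ)` generated by the images of the matrices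
`M₁ = [[t−1, u²],[1, 1]]` and `M₂ = [[u², u²],[1, t−u²]]`. -/
def Delta (u2 t : ℚ) : Subgroup PGL2Q :=
  Subgroup.closure (pgl ''
    {A : GL (Fin 2) ℚ | A.val = !![t - 1, u2; 1, 1] ∨ A.val = !![u2, u2; 1, t - u2]})

/-- The set `C(Γ)` of finite cusps of a subgroup `Γ ≤ PGL₂(ℚ)`: rationals fixed by a
parabolic element of `Γ` (an element `γ ≠ 1` with `tr(A)² = 4·det(A)` for a representative
`A ∈ GL₂(ℚ)`). -/
def finiteCusps (Γ : Subgroup PGL2Q) : Set ℚ :=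
  {x : ℚ | ∃ A : GL (Fin 2) ℚ, pgl A ∈ Γ ∧ pgl A ≠ 1 ∧
    (A.val.trace) ^ 2 = 4 * A.val.det ∧ moebius A (x : OnePoint ℚ) = (x : OnePoint ℚ)}

/-- The two generating matrices of `Δ(u²,2t)`. -/
def genMat (u t : ℚ) : Bool → Matrix (Fin 2) (Fin 2) ℚ
  | false => !![t - 1, u; 1, 1]
  | true => !![u, u; 1, t - u]

/-- A letter `(a, b)` of a word in the generators, evaluated at `m`. -/
def letter {G : Type*} [Group G] (m : Bool → G) (x : Bool × Bool) : G :=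
  cond x.2 (m x.1) (m x.1)⁻¹

/-- The letter inverse to `x`. -/
def flipLetter (x : Bool × Bool) : Bool × Bool := (x.1, !x.2)

/-- Quadratic forms whose nonnegativity loci are the four arcs cut out on the projective line by
the points `∞, -1, 0, u`; the arc of a letter contains the image of the complement of the arc of
the inverse letter. -/
def arcForm (u : ℚ) : Bool × Bool → (Fin 2 → ℚ) → ℚ
  | (false, true), v => v 1 * (v 0 - u * v 1)
  | (false, false), v => -(v 0 * (v 0 + v 1))
  | (true, true), v => -(v 0 * (v 0 - u * v 1))
  | (true, false), v => -(v 1 * (v 0 + v 1))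

lemma arcForm_nonpos_of_ne {u : ℚ} (hu : 0 < u) {x y : Bool × Bool} (hxy : x ≠ y)
    {v : Fin 2 → ℚ} (hx : 0 ≤ arcForm u x v) : arcForm u y v ≤ 0 := by
  by_contra! hy
  generalize ha : v 0 = a at *
  rcases x with ⟨_ | _, _ | _⟩ <;> rcases y with ⟨_ | _, _ | _⟩ <;>
    simp only [ne_eq, not_true_eq_false, arcForm, ha] at hxy hx hy <;>
    rcases lt_trichotomy a 0 with h0 | h0 | h0 <;>
    rcases lt_trichotomy (v 1) 0 with h1 | h1 | h1 <;>
    first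
    | nlinarith
    | (simp only [h0, h1] at hx hy; nlinarith)
    | (have := mul_pos hu h1; nlinarith)
    | (have := mul_neg_of_pos_of_neg hu h1; nlinarith)

lemma vertex_of_arcForm_nonneg {u : ℚ} (hu : 0 < u) {x y : Bool × Bool} (hxy : x ≠ y)
    {v : Fin 2 → ℚ} (hx : 0 ≤ arcForm u x v) (hy : 0 ≤ arcForm u y v) :
    v 1 = 0 ∨ v 0 = 0 ∨ v 0 = -v 1 ∨ v 0 = u * v 1 := by
  have h : arcForm u x v = 0 := le_antisymm (arcForm_nonpos_of_ne hu hxy.symm hy) hx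
  rcases x with ⟨_ | _, _ | _⟩ <;>
    simp only [arcForm, neg_eq_zero, mul_eq_zero, sub_eq_zero, add_eq_zero_iff_eq_neg] at h <;>
    tauto

lemma exists_arcForm_nonneg (u : ℚ) (x : Bool × Bool) :
    ∃ v : Fin 2 → ℚ, v ≠ 0 ∧ 0 ≤ arcForm u x v := by
  rcases x with ⟨_ | _, _ | _⟩
  · exact ⟨![0, 1], by simp, by simp [arcForm]⟩
  · exact ⟨![1, 0], by simp, by simp [arcForm]⟩
  · exact ⟨![1, 0], by simp, by simp [arcForm]⟩
  · exact ⟨![0, 1], by simp, by simp [arcForm]⟩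

lemma arcForm_smul (u : ℚ) (x : Bool × Bool) (c : ℚ) (v : Fin 2 → ℚ) :
    arcForm u x (c • v) = c ^ 2 * arcForm u x v := by
  rcases x with ⟨_ | _, _ | _⟩ <;> simp [arcForm] <;> ring

section PingPong

variable {u t : ℚ} {m : Bool → GL (Fin 2) ℚ}

lemma arcForm_gen_mulVec (u t : ℚ) (a : Bool) :
    ∃ c : ℚ, (0 < u → u < t - 1 → 0 < c) ∧ ∀ v : Fin 2 → ℚ,
      arcForm u (a, true) (genMat u t a *ᵥ v) = -c * arcForm u (a, false) v := by
  cases a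
  · refine ⟨t - 1 - u, fun _ _ => by linarith, fun v => ?_⟩
    simp [arcForm, genMat, Matrix.mulVec, dotProduct, Fin.sum_univ_two]
    ring
  · refine ⟨u ^ 2 * (t - 1 - u), fun h h' => by have := sub_pos.2 h'; positivity, fun v => ?_⟩
    simp [arcForm, genMat, Matrix.mulVec, dotProduct, Fin.sum_univ_two]
    ring

lemma arcForm_letter_mulVec (hu : 0 < u) (ht : u < t - 1) (hm : ∀ a, (m a).val = genMat u t a)
    (x : Bool × Bool) {v : Fin 2 → ℚ} (hv : arcForm u (flipLetter x) v ≤ 0) :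
    0 ≤ arcForm u x ((letter m x).val *ᵥ v) := by
  obtain ⟨a, b⟩ := x
  obtain ⟨c, hc, h⟩ := arcForm_gen_mulVec u t a
  specialize hc hu ht
  cases b
  · have h2 := h ((m a)⁻¹.val *ᵥ v)
    rw [← hm, Matrix.mulVec_mulVec, ← Units.val_mul, mul_inv_cancel, Units.val_one,
      Matrix.one_mulVec] at h2
    simp only [flipLetter, Bool.not_false] at hv
    simp only [letter, cond_false]
    nlinarith
  · simp only [flipLetter, Bool.not_true] at hv
    simp only [letter, cond_true, hm, h]
    nlinarith

/-- Ping-pong: a reduced word maps every arc, except that of the inverse of its last letter, into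
the arc of its first letter. -/
lemma arcForm_word_mulVec (hu : 0 < u) (ht : u < t - 1) (hm : ∀ a, (m a).val = genMat u t a)
    (L : List (Bool × Bool)) (x : Bool × Bool) (hL : FreeGroup.IsReduced (x :: L))
    (y : Bool × Bool) (hy : ∀ z ∈ (x :: L).getLast?, flipLetter z ≠ y)
    {v : Fin 2 → ℚ} (hv : 0 ≤ arcForm u y v) :
    0 ≤ arcForm u x (((x :: L).map (letter m)).prod.val *ᵥ v) := by
  induction L generalizing x with
  | nil =>
    simp only [List.map_cons, List.map_nil, List.prod_cons, List.prod_nil, mul_one]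
    exact arcForm_letter_mulVec hu ht hm x (arcForm_nonpos_of_ne hu (hy x (by simp)).symm hv)
  | cons z L ih =>
    rw [List.map_cons, List.prod_cons, Units.val_mul, ← Matrix.mulVec_mulVec]
    rw [FreeGroup.IsReduced, List.isChain_cons_cons] at hL
    refine arcForm_letter_mulVec hu ht hm x (arcForm_nonpos_of_ne hu ?_
      (ih z hL.2 fun w hw => hy w (by rw [List.getLast?_cons_cons]; exact hw)))
    rintro rfl
    simpa [flipLetter] using hL.1 rfl

end PingPong

/-- A homogeneous parabolicity condition: `v` spans the unique fixed line of `A`. -/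
structure ParabolicAt (A : GL (Fin 2) ℚ) (v : Fin 2 → ℚ) : Prop where
  ne_zero : v ≠ 0
  eigen : ∃ s : ℚ, A.val *ᵥ v = s • v
  trace_sq : A.val.trace ^ 2 = 4 * A.val.det
  not_central : A ∉ Subgroup.center (GL (Fin 2) ℚ)

namespace ParabolicAt

variable {A : GL (Fin 2) ℚ} {v : Fin 2 → ℚ}

lemma conj (h : ParabolicAt A v) (g : GL (Fin 2) ℚ) :
    ParabolicAt (g * A * g⁻¹) (g.val *ᵥ v) where
  ne_zero h0 := h.ne_zero <| by
    have : g⁻¹.val *ᵥ (g.val *ᵥ v) = g⁻¹.val *ᵥ 0 := by rw [h0]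
    rwa [Matrix.mulVec_mulVec, ← Units.val_mul, inv_mul_cancel, Units.val_one, Matrix.one_mulVec,
      Matrix.mulVec_zero] at this
  eigen := by
    obtain ⟨s, hs⟩ := h.eigen
    refine ⟨s, ?_⟩
    rw [Matrix.mulVec_mulVec, ← Units.val_mul, inv_mul_cancel_right, Units.val_mul,
      ← Matrix.mulVec_mulVec, hs, Matrix.mulVec_smul]
  trace_sq := by
    rw [Units.val_mul, Units.val_mul, Matrix.trace_mul_cycle, Matrix.det_mul_right_comm,
      ← Units.val_mul g⁻¹ g, ← Units.val_mul g g⁻¹, inv_mul_cancel, mul_inv_cancel]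
    simpa using h.trace_sq
  not_central hc := h.not_central <| by
    have := (inferInstance : (Subgroup.center (GL (Fin 2) ℚ)).Normal).conj_mem _ hc g⁻¹
    simpa [mul_assoc] using this

lemma mul_central (h : ParabolicAt A v) {z : GL (Fin 2) ℚ}
    (hz : z ∈ Subgroup.center (GL (Fin 2) ℚ)) : ParabolicAt (A * z) v := by
  obtain ⟨c, hc⟩ := Matrix.GeneralLinearGroup.mem_center_iff_val_mem_range_scalar.1 hz
  have hval : (A * z).val = c • A.val := by
    rw [Units.val_mul, ← hc]
    ext i j
    simp [mul_comm]
  refine ⟨h.ne_zero, ?_, ?_, fun hAz => h.not_central ?_⟩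
  · obtain ⟨s, hs⟩ := h.eigen
    exact ⟨c * s, by rw [hval, Matrix.smul_mulVec, hs, smul_smul]⟩
  · rw [hval, Matrix.trace_smul, Matrix.det_smul, Fintype.card_fin, smul_eq_mul, mul_pow,
      h.trace_sq]
    ring
  · simpa using Subgroup.mul_mem _ hAz (Subgroup.inv_mem _ hz)

lemma inv (h : ParabolicAt A v) : ParabolicAt A⁻¹ v := by
  have hdet : A.val.det * A⁻¹.val.det = 1 := by
    rw [← Matrix.det_mul, ← Units.val_mul, mul_inv_cancel, Units.val_one, Matrix.det_one]
  refine ⟨h.ne_zero, ?_, ?_, fun hc => h.not_central (by simpa using Subgroup.inv_mem _ hc)⟩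
  · obtain ⟨s, hs⟩ := h.eigen
    have h1 : v = s • (A⁻¹.val *ᵥ v) := by
      rw [← Matrix.mulVec_smul, ← hs, Matrix.mulVec_mulVec, ← Units.val_mul, inv_mul_cancel,
        Units.val_one, Matrix.one_mulVec]
    have hs0 : s ≠ 0 := by
      rintro rfl
      exact h.ne_zero (by rw [h1, zero_smul])
    exact ⟨s⁻¹, by rw [eq_inv_smul_iff₀ hs0]; exact h1.symm⟩
  · have htr : A⁻¹.val.trace = A⁻¹.val.det * A.val.trace := by
      have h1 : A⁻¹.val = A⁻¹.val.det • A.val.adjugate := by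
        calc A⁻¹.val = A⁻¹.val * (A.val * A.val.adjugate) * A⁻¹.val.det • 1 := by
              rw [Matrix.mul_adjugate]
              simp only [Matrix.mul_smul, Matrix.mul_one, smul_smul, mul_comm A⁻¹.val.det, hdet,
                one_smul]
          _ = _ := by
              rw [← mul_assoc, ← Units.val_mul, inv_mul_cancel, Units.val_one, one_mul,
                Matrix.mul_smul, Matrix.mul_one]
      conv_lhs => rw [h1]
      rw [Matrix.trace_smul, Matrix.adjugate_fin_two, smul_eq_mul]
      simp [Matrix.trace_fin_two, add_comm]
    rw [htr, mul_pow, h.trace_sq]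
    linear_combination 4 * A⁻¹.val.det * hdet

/-- A parabolic matrix acts as a transvection, up to scaling. -/
lemma exists_transvection (h : ParabolicAt A v) :
    ∃ s n : ℚ, s ≠ 0 ∧ n ≠ 0 ∧ A.val *ᵥ v = s • v ∧
      ∀ w : Fin 2 → ℚ, A.val *ᵥ w = s • w + (n * (v 1 * w 0 - v 0 * w 1)) • v := by
  obtain ⟨s, hs⟩ := h.eigen
  have hdet : A.val.det ≠ 0 := ((Matrix.isUnit_iff_isUnit_det _).1 A.isUnit).ne_zero
  have htr := h.trace_sq
  have hnc : ¬ (A.val 0 1 = 0 ∧ A.val 1 0 = 0 ∧ A.val 0 0 = s ∧ A.val 1 1 = s) := by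
    rintro ⟨h1, h2, h3, h4⟩
    refine h.not_central
      (Matrix.GeneralLinearGroup.mem_center_iff_val_mem_range_scalar.2 ⟨s, ?_⟩)
    ext i j
    fin_cases i <;> fin_cases j <;> simp [h1, h2, h3, h4]
  have hv0 : v 0 ≠ 0 ∨ v 1 ≠ 0 := by
    by_contra! h0
    exact h.ne_zero (by ext i; fin_cases i <;> simp [h0])
  have e0 := congrFun hs 0
  have e1 := congrFun hs 1
  simp only [Matrix.mulVec, dotProduct, Fin.sum_univ_two, Pi.smul_apply, smul_eq_mul] at e0 e1
  rw [Matrix.trace_fin_two, Matrix.det_fin_two] at htr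
  rw [Matrix.det_fin_two] at hdet
  suffices H : ∃ n, A.val 0 0 = s + n * v 0 * v 1 ∧ A.val 0 1 = -n * v 0 ^ 2 ∧
      A.val 1 0 = n * v 1 ^ 2 ∧ A.val 1 1 = s - n * v 0 * v 1 by
    obtain ⟨n, h00, h01, h10, h11⟩ := H
    refine ⟨s, n, ?_, ?_, hs, fun w => ?_⟩
    · rintro rfl
      apply hdet
      rw [h00, h01, h10, h11]
      ring
    · rintro rfl
      simp [h00, h01, h10, h11] at hnc
    · ext i
      fin_cases i <;> simp [Matrix.mulVec, dotProduct, Fin.sum_univ_two, h00, h01, h10, h11] <;>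
        ring
  have hdisc : A.val 0 0 + A.val 1 1 = 2 * s := by
    have hchar : s ^ 2 - s * (A.val 0 0 + A.val 1 1) +
        (A.val 0 0 * A.val 1 1 - A.val 0 1 * A.val 1 0) = 0 := by
      rcases hv0 with h0 | h0 <;> apply mul_right_cancel₀ h0
      · linear_combination (-s + A.val 1 1) * e0 - A.val 0 1 * e1
      · linear_combination (-s + A.val 0 0) * e1 - A.val 1 0 * e0
    have : (A.val 0 0 + A.val 1 1 - 2 * s) ^ 2 = 0 := by linear_combination htr + 4 * hchar
    linarith [pow_eq_zero_iff (two_ne_zero) |>.1 this]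
  rcases eq_or_ne (v 0) 0 with h0 | h0
  · have h1 : v 1 ≠ 0 := by tauto
    rw [h0] at e0 e1
    have h01 : A.val 0 1 = 0 := by simpa [h1] using e0
    have h11 : A.val 1 1 = s := by simpa [h1] using e1
    refine ⟨A.val 1 0 / v 1 ^ 2, ?_, ?_, ?_, ?_⟩
    · rw [h0]; linarith
    · rw [h0, h01]; simp
    · field_simp
    · rw [h0]; linarith
  · refine ⟨-A.val 0 1 / v 0 ^ 2, ?_, ?_, ?_, ?_⟩ <;> field_simp
    · linear_combination e0
    · linear_combination v 0 * e1 - v 0 * v 1 * hdisc + v 1 * e0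
    · linear_combination v 0 * hdisc - e0

end ParabolicAt

lemma nonneg_of_forall_quadratic_nonneg {a b c : ℚ} (h : ∀ k : ℕ, 0 ≤ a + k * b + k ^ 2 * c) :
    0 ≤ c := by
  by_contra! hc
  obtain ⟨k, hk⟩ := exists_nat_gt ((|a| + |b|) / -c)
  have hc' : 0 < -c := by linarith
  rw [div_lt_iff₀ hc'] at hk
  have h1 := h (k + 1)
  push_cast at h1
  have hk0 : (0 : ℚ) ≤ k := k.cast_nonneg
  have ha := le_abs_self a
  have hb := le_abs_self b
  have ha' := abs_nonneg a
  have hb' := abs_nonneg b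
  nlinarith [mul_nonneg hk0 ha', mul_nonneg hk0 (sub_nonneg.2 hb)]

lemma arcForm_add_smul (u : ℚ) (x : Bool × Bool) (w v : Fin 2 → ℚ) :
    ∃ b : ℚ, ∀ k : ℚ, arcForm u x (w + k • v) = arcForm u x w + k * b + k ^ 2 * arcForm u x v := by
  refine ⟨arcForm u x (w + v) - arcForm u x w - arcForm u x v, fun k => ?_⟩
  rcases x with ⟨_ | _, _ | _⟩ <;> simp [arcForm] <;> ring

/-- The fixed point of a parabolic that maps an arc into itself lies in that arc. -/
lemma ParabolicAt.arcForm_nonneg {u : ℚ} {A : GL (Fin 2) ℚ} {v : Fin 2 → ℚ}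
    (h : ParabolicAt A v) (x : Bool × Bool)
    (hA : ∀ w, 0 ≤ arcForm u x w → 0 ≤ arcForm u x (A.val *ᵥ w)) : 0 ≤ arcForm u x v := by
  obtain ⟨s, n, hs, hn, hv, hw⟩ := h.exists_transvection
  obtain ⟨w, hw0, hwx⟩ := exists_arcForm_nonneg u x
  set c := n * (v 1 * w 0 - v 0 * w 1) with hc
  have hs2 : 0 < s ^ 2 := by positivity
  rcases eq_or_ne c 0 with h0 | h0
  · have h1 : v 1 * w 0 - v 0 * w 1 = 0 := (mul_eq_zero.1 (hc.symm.trans h0)).resolve_left hn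
    have hprop : ∃ d : ℚ, w = d • v := by
      rcases eq_or_ne (v 0) 0 with hv0 | hv0
      · have hv1 : v 1 ≠ 0 := fun hv1 => h.ne_zero (by ext i; fin_cases i <;> simp [hv0, hv1])
        refine ⟨w 1 / v 1, ?_⟩
        have : w 0 = 0 := by simpa [hv0, hv1] using h1
        ext i
        fin_cases i <;> simp [hv0, hv1, this]
      · refine ⟨w 0 / v 0, ?_⟩
        ext i
        fin_cases i
        · simp [hv0]
        · simp only [Fin.mk_one, Pi.smul_apply, smul_eq_mul]
          field_simp
          linarith
    obtain ⟨d, rfl⟩ := hprop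
    have hd : d ≠ 0 := by
      rintro rfl
      simp at hw0
    rw [arcForm_smul] at hwx
    exact nonneg_of_mul_nonneg_right hwx (by positivity)
  · have key : ∀ k : ℕ, 0 ≤ arcForm u x (s • w + (k * c) • v) := by
      intro k
      induction k with
      | zero =>
        simp only [Nat.cast_zero, zero_mul, zero_smul, add_zero, arcForm_smul]
        positivity
      | succ k ih =>
        have h1 := hA _ ih
        have h2 : A.val *ᵥ (s • w + (k * c) • v) = s • (s • w + ((k + 1 : ℕ) * c) • v) := by
          rw [Matrix.mulVec_add, Matrix.mulVec_smul, Matrix.mulVec_smul, hv, hw, ← hc]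
          push_cast
          module
        rw [h2, arcForm_smul] at h1
        exact nonneg_of_mul_nonneg_right h1 hs2
    obtain ⟨b, hb⟩ := arcForm_add_smul u x (s • w) v
    have := nonneg_of_forall_quadratic_nonneg (a := arcForm u x (s • w)) (b := c * b)
      (c := c ^ 2 * arcForm u x v) fun k => by
        have h1 := key k
        rw [hb] at h1
        linarith
    exact nonneg_of_mul_nonneg_right this (by positivity)

/-- The fixed point of a parabolic cyclically reduced word is one of `∞, 0, -1, u`. -/
lemma vertex_of_isCyclicallyReduced {u t : ℚ} (hu : 0 < u) (ht : u < t - 1)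
    {m : Bool → GL (Fin 2) ℚ} (hm : ∀ a, (m a).val = genMat u t a) {L : List (Bool × Bool)}
    (hL : FreeGroup.IsCyclicallyReduced L) (hL0 : L ≠ []) {v : Fin 2 → ℚ}
    (hv : ParabolicAt (FreeGroup.lift m (FreeGroup.mk L)) v) :
    v 1 = 0 ∨ v 0 = 0 ∨ v 0 = -v 1 ∨ v 0 = u * v 1 := by
  have stable : ∀ (L : List (Bool × Bool)), FreeGroup.IsReduced L → ∀ x ∈ L.head?,
      (∀ z ∈ L.getLast?, flipLetter z ≠ x) → ∀ v,
      ParabolicAt (FreeGroup.lift m (FreeGroup.mk L)) v → 0 ≤ arcForm u x v := by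
    intro L hL x hx hz v hv
    obtain ⟨L, rfl⟩ : ∃ L', L = x :: L' := by
      cases L with
      | nil => simp at hx
      | cons a L => exact ⟨L, by simpa using hx⟩
    refine hv.arcForm_nonneg x fun w hw => ?_
    rw [FreeGroup.lift_mk]
    exact arcForm_word_mulVec hu ht hm L x hL x hz hw
  have hx := List.head?_eq_some_head hL0
  have hz := List.getLast?_eq_some_getLast hL0
  set x := L.head hL0
  set z := L.getLast hL0
  have hne : flipLetter z ≠ x := by
    intro h
    have := hL.2 z hz x hx (congrArg Prod.fst h :)
    rw [← h] at this
    simp [flipLetter] at this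
  have hred : FreeGroup.IsReduced (FreeGroup.invRev L) := by
    rw [FreeGroup.isReduced_iff_reduce_eq, FreeGroup.reduce_invRev, hL.1.reduce_eq]
  refine vertex_of_arcForm_nonneg hu hne.symm
    (stable L hL.1 x hx (fun y hy => ?_) v hv)
    (stable (FreeGroup.invRev L) hred (flipLetter z) ?_ ?_ v ?_)
  · rw [hz, Option.mem_some_iff] at hy
    rwa [← hy]
  · simp [FreeGroup.invRev, List.head?_reverse, hz, flipLetter]
  · intro y hy
    simp only [FreeGroup.invRev, List.getLast?_reverse, List.head?_map, hx, Option.map_some,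
      Option.mem_some_iff] at hy
    rw [← hy]
    simpa [flipLetter] using hne.symm
  · rw [← FreeGroup.inv_mk, map_inv]
    exact hv.inv

/-- The fixed point of a parabolic word is a translate of one of `∞, 0, -1, u`. -/
lemma exists_translate_vertex {u t : ℚ} (hu : 0 < u) (ht : u < t - 1)
    {m : Bool → GL (Fin 2) ℚ} (hm : ∀ a, (m a).val = genMat u t a) (w : FreeGroup Bool)
    {v : Fin 2 → ℚ} (hv : ParabolicAt (FreeGroup.lift m w) v) :
    ∃ (g : FreeGroup Bool) (v' : Fin 2 → ℚ), v' ≠ 0 ∧ v = (FreeGroup.lift m g).val *ᵥ v' ∧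
      (v' 1 = 0 ∨ v' 0 = 0 ∨ v' 0 = -v' 1 ∨ v' 0 = u * v' 1) := by
  set c := FreeGroup.mk (FreeGroup.reduceCyclically.conjugator w.toWord) with hc
  set L := FreeGroup.reduceCyclically w.toWord with hL
  have hw : w = c * FreeGroup.mk L * c⁻¹ := by
    rw [hc, FreeGroup.inv_mk, FreeGroup.mul_mk, FreeGroup.mul_mk,
      FreeGroup.reduceCyclically.conj_conjugator_reduceCyclically, FreeGroup.mk_toWord]
  have hv' := hv.conj (FreeGroup.lift m c⁻¹)
  rw [← map_mul, ← map_inv, ← map_mul,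
    show c⁻¹ * w * c⁻¹⁻¹ = FreeGroup.mk L by rw [hw]; group] at hv'
  refine ⟨c, _, hv'.ne_zero, ?_, vertex_of_isCyclicallyReduced hu ht hm
    (FreeGroup.reduceCyclically.isCyclicallyReduced FreeGroup.isReduced_toWord) ?_ hv'⟩
  · rw [Matrix.mulVec_mulVec, ← Units.val_mul, ← map_mul, mul_inv_cancel, map_one, Units.val_one,
      Matrix.one_mulVec]
  · intro h
    apply hv'.not_central
    rw [show L = [] from h, ← FreeGroup.one_eq_mk, map_one]
    exact Subgroup.one_mem _

/-- A predicate on nonzero vectors invariant under the generators is invariant under words. -/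
lemma mulVec_lift_invariant {m : Bool → GL (Fin 2) ℚ} {P : (Fin 2 → ℚ) → Prop}
    (hP : ∀ a v, v ≠ 0 → (P ((m a).val *ᵥ v) ↔ P v)) (g : FreeGroup Bool) :
    ∀ v, v ≠ 0 → (P ((FreeGroup.lift m g).val *ᵥ v) ↔ P v) := by
  have hne : ∀ (A : GL (Fin 2) ℚ) (v : Fin 2 → ℚ), v ≠ 0 → A.val *ᵥ v ≠ 0 := by
    intro A v hv h0
    have : A⁻¹.val *ᵥ (A.val *ᵥ v) = A⁻¹.val *ᵥ 0 := by rw [h0]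
    rw [Matrix.mulVec_mulVec, ← Units.val_mul, inv_mul_cancel, Units.val_one, Matrix.one_mulVec,
      Matrix.mulVec_zero] at this
    exact hv this
  induction g using FreeGroup.induction_on with
  | C1 => simp
  | of a => simpa using hP a
  | inv_of a _ =>
    intro v hv
    have := hP a _ (hne (m a)⁻¹ v hv)
    rw [Matrix.mulVec_mulVec, ← Units.val_mul, mul_inv_cancel, Units.val_one,
      Matrix.one_mulVec] at this
    rw [map_inv, FreeGroup.lift_apply_of]
    exact this.symm
  | mul x y hx hy =>
    intro v hv
    rw [map_mul, Units.val_mul, ← Matrix.mulVec_mulVec, hx _ (hne _ v hv), hy v hv]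

lemma padicNorm.eq_of_padicValRat_eq_neg_one {p : ℕ} {u : ℚ} (hu : padicValRat p u = -1) :
    padicNorm p u = p := by
  have h : u ≠ 0 := by
    rintro rfl
    simp at hu
  simp [padicNorm.eq_zpow_of_nonzero h, hu]

section Padic

variable {p : ℕ} [hp : Fact p.Prime]

lemma padicNorm.prime_mul_le_of_lt {a b : ℚ} (h : padicNorm p b < padicNorm p a) :
    p * padicNorm p b ≤ padicNorm p a := by
  have hp1 : (1 : ℚ) < p := by exact_mod_cast hp.out.one_lt
  have hp0 : (p : ℚ) ≠ 0 := by positivity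
  rcases eq_or_ne b 0 with rfl | hb
  · simpa using padicNorm.nonneg a
  have ha : a ≠ 0 := by
    rintro rfl
    simpa using h.trans_le' (padicNorm.nonneg b)
  obtain ⟨i, hi⟩ := padicNorm.values_discrete (p := p) ha
  obtain ⟨j, hj⟩ := padicNorm.values_discrete (p := p) hb
  rw [hi, hj] at h ⊢
  rw [zpow_lt_zpow_iff_right₀ hp1] at h
  rw [← zpow_one_add₀ hp0, zpow_le_zpow_iff_right₀ hp1]
  omega

lemma padicNorm.le_one_of_padicValRat_nonneg {t : ℚ} (ht : 0 ≤ padicValRat p t) :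
    padicNorm p t ≤ 1 := by
  have hp1 : (1 : ℚ) ≤ p := by exact_mod_cast hp.out.one_le
  rcases eq_or_ne t 0 with rfl | h
  · simp
  · rw [padicNorm.eq_zpow_of_nonzero h]
    exact zpow_le_one_of_nonpos₀ hp1 (by omega)

lemma padicNorm.add_eq_right_of_lt {a b : ℚ} (h : padicNorm p a < padicNorm p b) :
    padicNorm p (a + b) = padicNorm p b := by
  rw [padicNorm.add_eq_max_of_ne h.ne, max_eq_right h.le]

variable {u t : ℚ}

/-- `M₁` swaps the `p`-adic integers with their complement in the projective line. -/
lemma padicNorm_genMat_false (hu : padicNorm p u = p) (ht : padicNorm p t ≤ 1) {v : Fin 2 → ℚ}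
    (hv : v ≠ 0) :
    padicNorm p ((genMat u t false *ᵥ v) 0) ≤ padicNorm p ((genMat u t false *ᵥ v) 1) ↔
      ¬ padicNorm p (v 0) ≤ padicNorm p (v 1) := by
  have hp1 : (1 : ℚ) < p := by exact_mod_cast hp.out.one_lt
  have e0 : (genMat u t false *ᵥ v) 0 = (t - 1) * v 0 + u * v 1 := by
    simp [genMat, Matrix.mulVec, dotProduct, Fin.sum_univ_two]
  have e1 : (genMat u t false *ᵥ v) 1 = v 1 + v 0 := by
    simp [genMat, Matrix.mulVec, dotProduct, Fin.sum_univ_two, add_comm]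
  have ht1 : padicNorm p (t - 1) ≤ 1 := padicNorm.sub.trans (by simp [ht])
  have h0 := padicNorm.nonneg (p := p) (v 0)
  have h1 : padicNorm p ((t - 1) * v 0) ≤ padicNorm p (v 0) := by
    rw [padicNorm.mul]
    exact mul_le_of_le_one_left h0 ht1
  rw [e0, e1]
  by_cases h : padicNorm p (v 0) ≤ padicNorm p (v 1)
  · have hv1 : v 1 ≠ 0 := by
      intro hv1
      rw [hv1, padicNorm.zero] at h
      have := padicNorm.zero_of_padicNorm_eq_zero (le_antisymm h h0)
      exact hv (by ext i; fin_cases i <;> simp [this, hv1])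
    have hpos : 0 < padicNorm p (v 1) :=
      lt_of_le_of_ne (padicNorm.nonneg _) (padicNorm.nonzero hv1).symm
    have h2 : padicNorm p (v 1) < padicNorm p (u * v 1) := by
      rw [padicNorm.mul, hu]
      exact lt_mul_of_one_lt_left hpos hp1
    rw [padicNorm.add_eq_right_of_lt ((h1.trans h).trans_lt h2)]
    have h3 := padicNorm.nonarchimedean (p := p) (q := v 1) (r := v 0)
    rw [max_eq_left h] at h3
    simp only [h, not_true_eq_false, iff_false, not_le]
    exact h3.trans_lt h2
  · simp only [h, not_false_eq_true, iff_true]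
    rw [not_le] at h
    rw [padicNorm.add_eq_right_of_lt h]
    refine padicNorm.nonarchimedean.trans (max_le h1 ?_)
    rw [padicNorm.mul, hu]
    exact padicNorm.prime_mul_le_of_lt h

/-- `M₂` preserves the `p`-adic integers. -/
lemma padicNorm_genMat_true (hu : padicNorm p u = p) (ht : padicNorm p t ≤ 1) {v : Fin 2 → ℚ}
    (hv : v ≠ 0) :
    padicNorm p ((genMat u t true *ᵥ v) 0) ≤ padicNorm p ((genMat u t true *ᵥ v) 1) ↔
      padicNorm p (v 0) ≤ padicNorm p (v 1) := by
  have hp1 : (1 : ℚ) < p := by exact_mod_cast hp.out.one_lt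
  have hp0 : (0 : ℚ) < p := by positivity
  have e0 : (genMat u t true *ᵥ v) 0 = u * (v 1 + v 0) := by
    simp [genMat, Matrix.mulVec, dotProduct, Fin.sum_univ_two]
    ring
  have e1 : (genMat u t true *ᵥ v) 1 = (v 0 + t * v 1) + -(u * v 1) := by
    simp [genMat, Matrix.mulVec, dotProduct, Fin.sum_univ_two]
    ring
  have h0 := padicNorm.nonneg (p := p) (v 0)
  have h1 := padicNorm.nonneg (p := p) (v 1)
  have h2 : padicNorm p (t * v 1) ≤ padicNorm p (v 1) := by
    rw [padicNorm.mul]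
    exact mul_le_of_le_one_left h1 ht
  rw [e0, e1, padicNorm.mul, hu]
  by_cases h : padicNorm p (v 0) ≤ padicNorm p (v 1)
  · have hv1 : v 1 ≠ 0 := by
      intro hv1
      rw [hv1, padicNorm.zero] at h
      have := padicNorm.zero_of_padicNorm_eq_zero (le_antisymm h h0)
      exact hv (by ext i; fin_cases i <;> simp [this, hv1])
    have hpos : 0 < padicNorm p (v 1) := lt_of_le_of_ne h1 (padicNorm.nonzero hv1).symm
    have h3 : padicNorm p (v 1) < padicNorm p (-(u * v 1)) := by
      rw [padicNorm.neg, padicNorm.mul, hu]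
      exact lt_mul_of_one_lt_left hpos hp1
    have h4 : padicNorm p (v 0 + t * v 1) ≤ padicNorm p (v 1) :=
      padicNorm.nonarchimedean.trans (max_le h h2)
    rw [padicNorm.add_eq_right_of_lt (h4.trans_lt h3), padicNorm.neg, padicNorm.mul, hu]
    simp only [h, iff_true]
    refine mul_le_mul_of_nonneg_left ?_ hp0.le
    exact padicNorm.nonarchimedean.trans (max_le le_rfl h)
  · simp only [h, iff_false, not_le]
    rw [not_le] at h
    rw [padicNorm.add_eq_right_of_lt h]
    have h5 : padicNorm p ((v 0 + t * v 1) + -(u * v 1)) ≤ padicNorm p (v 0) := by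
      refine padicNorm.nonarchimedean.trans (max_le
        (padicNorm.nonarchimedean.trans (max_le le_rfl (h2.trans h.le))) ?_)
      rw [padicNorm.neg, padicNorm.mul, hu]
      exact padicNorm.prime_mul_le_of_lt h
    exact h5.trans_lt (lt_mul_of_one_lt_left (h1.trans_lt h) hp1)

lemma padicNorm_vertex (hu : padicNorm p u = p) {v : Fin 2 → ℚ} (hv : v ≠ 0)
    (h : v 1 = 0 ∨ v 0 = 0 ∨ v 0 = -v 1 ∨ v 0 = u * v 1) :
    padicNorm p (v 0) ≤ padicNorm p (v 1) ↔ v 0 = 0 ∨ v 0 = -v 1 := by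
  have hp1 : (1 : ℚ) < p := by exact_mod_cast hp.out.one_lt
  have hu0 : u ≠ 0 := by
    rintro rfl
    rw [padicNorm.zero] at hu
    linarith
  have hu1 : u ≠ -1 := by
    rintro rfl
    rw [padicNorm.neg, padicNorm.one] at hu
    exact hp1.ne hu
  have hv0 : v 1 = 0 → v 0 ≠ 0 := fun h1 h0 =>
    hv (by ext i; fin_cases i <;> simp [h0, h1])
  rcases eq_or_ne (v 1) 0 with h1 | h1
  · have hpos := (padicNorm.nonneg (p := p) (v 0)).lt_of_ne' (padicNorm.nonzero (hv0 h1))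
    rw [h1, padicNorm.zero, neg_zero, or_self]
    simp only [hv0 h1, iff_false, not_le, hpos]
  · have hpos := (padicNorm.nonneg (p := p) (v 1)).lt_of_ne' (padicNorm.nonzero h1)
    rcases h with h | h | h | h
    · exact absurd h h1
    · simp [h, hpos.le]
    · simp [h]
    · have hne : u * v 1 ≠ -v 1 := fun h2 => hu1 (mul_right_cancel₀ h1 (by linarith))
      simp only [h, padicNorm.mul, hu, mul_eq_zero, hu0, h1, hne, or_self, iff_false, not_le]
      exact lt_mul_of_one_lt_left hpos hp1

end Padic

/-- Every finite cusp is the affine coordinate of the fixed line of a parabolic word. -/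
lemma exists_word_of_mem_finiteCusps {u t : ℚ} {m : Bool → GL (Fin 2) ℚ}
    (hm : ∀ a, (m a).val = genMat u t a) {x : ℚ} (hx : x ∈ finiteCusps (Delta u t)) :
    ∃ w : FreeGroup Bool, ParabolicAt (FreeGroup.lift m w) ![x, 1] := by
  obtain ⟨A, hA, hA1, htr, hfix⟩ := hx
  have hle : Delta u t ≤ ((FreeGroup.lift m).range).map pgl := by
    rw [Delta, Subgroup.closure_le]
    rintro _ ⟨B, hB | hB, rfl⟩
    · refine ⟨B, ⟨FreeGroup.of false, ?_⟩, rfl⟩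
      rw [FreeGroup.lift_apply_of]
      exact Units.ext ((hm false).trans hB.symm)
    · refine ⟨B, ⟨FreeGroup.of true, ?_⟩, rfl⟩
      rw [FreeGroup.lift_apply_of]
      exact Units.ext ((hm true).trans hB.symm)
  obtain ⟨_, ⟨w, rfl⟩, hw⟩ := hle hA
  have hpar : ParabolicAt A ![x, 1] := by
    refine ⟨fun h => by simpa using congrFun h 1, ?_, htr, fun h => hA1 ?_⟩
    · have hne : A.val 1 0 * x + A.val 1 1 ≠ 0 := by
        intro h0
        have : moebius A (x : OnePoint ℚ) = OnePoint.infty := if_pos h0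
        rw [hfix] at this
        exact OnePoint.coe_ne_infty x this
      have heq : (A.val 0 0 * x + A.val 0 1) / (A.val 1 0 * x + A.val 1 1) = x := by
        have : moebius A (x : OnePoint ℚ) =
            (((A.val 0 0 * x + A.val 0 1) / (A.val 1 0 * x + A.val 1 1) : ℚ) : OnePoint ℚ) :=
          if_neg hne
        exact OnePoint.coe_injective (this.symm.trans hfix)
      rw [div_eq_iff hne] at heq
      refine ⟨A.val 1 0 * x + A.val 1 1, ?_⟩
      ext i
      fin_cases i <;> simp [Matrix.mulVec, dotProduct, Fin.sum_univ_two, heq, mul_comm x]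
    · exact (QuotientGroup.eq_one_iff A).2 h
  refine ⟨w, ?_⟩
  have hz : A⁻¹ * FreeGroup.lift m w ∈ Subgroup.center (GL (Fin 2) ℚ) :=
    QuotientGroup.eq.1 hw.symm
  simpa using hpar.mul_central hz

/-- A finite cusp is integral at `p` if and only if it is integral at `q`. -/
lemma padicNorm_le_one_iff_of_mem_finiteCusps {u t : ℚ} (h0 : 0 < u) (h1 : u < t - 1)
    {p q : ℕ} [Fact p.Prime] [Fact q.Prime]
    (hup : padicValRat p u = -1) (huq : padicValRat q u = -1)
    (htp : 0 ≤ padicValRat p t) (htq : 0 ≤ padicValRat q t) {x : ℚ}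
    (hx : x ∈ finiteCusps (Delta u t)) : padicNorm p x ≤ 1 ↔ padicNorm q x ≤ 1 := by
  replace hup := padicNorm.eq_of_padicValRat_eq_neg_one hup
  replace huq := padicNorm.eq_of_padicValRat_eq_neg_one huq
  replace htp := padicNorm.le_one_of_padicValRat_nonneg htp
  replace htq := padicNorm.le_one_of_padicValRat_nonneg htq
  have hdet : ∀ a, (genMat u t a).det ≠ 0 := by
    have hd : t - 1 - u ≠ 0 := (sub_pos.2 h1).ne'
    rintro (_ | _)
    · simpa [genMat, Matrix.det_fin_two] using hd
    · have h : (genMat u t true).det = u * (t - 1 - u) := by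
        simp [genMat, Matrix.det_fin_two]
        ring
      rw [h]
      exact mul_ne_zero h0.ne' hd
  set m : Bool → GL (Fin 2) ℚ := fun a => Matrix.GeneralLinearGroup.mkOfDetNeZero _ (hdet a)
  have hm : ∀ a, (m a).val = genMat u t a := fun a => rfl
  obtain ⟨w, hw⟩ := exists_word_of_mem_finiteCusps hm hx
  obtain ⟨g, v, hv, hxv, hvert⟩ := exists_translate_vertex h0 h1 hm w hw
  have key := mulVec_lift_invariant (m := m)
    (P := fun v => (padicNorm p (v 0) ≤ padicNorm p (v 1) ↔ padicNorm q (v 0) ≤ padicNorm q (v 1)))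
    (fun a v hv => by
      rw [hm]
      cases a
      · rw [padicNorm_genMat_false hup htp hv, padicNorm_genMat_false huq htq hv, not_iff_not]
      · rw [padicNorm_genMat_true hup htp hv, padicNorm_genMat_true huq htq hv]) g v hv
  rw [← hxv] at key
  simpa using key.2 ((padicNorm_vertex hup hv hvert).trans (padicNorm_vertex huq hv hvert).symm)

/-- **Proposition 4.** Let `0 < u² < t − 1` and let `p ≠ q` be primes with
`v_p(u²) = −1 = v_q(u²)` and `t` integral at `p` and at `q`. Then the finite cusp set of
`Δ(u²,2t)` is not dense in `ℚ_p × ℚ_q`. -/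
theorem cusps_not_dense_padic_prod (u2 t : ℚ) (h0 : 0 < u2) (h1 : u2 < t - 1)
    (p q : ℕ) [Fact p.Prime] [Fact q.Prime] (hpq : p ≠ q)
    (hup : padicValRat p u2 = -1) (huq : padicValRat q u2 = -1)
    (htp : 0 ≤ padicValRat p t) (htq : 0 ≤ padicValRat q t) :
    ¬ Dense ((fun x : ℚ => ((x : ℚ_[p]), (x : ℚ_[q]))) '' finiteCusps (Delta u2 t)) := by
  intro hd
  obtain ⟨_, ⟨h1p, h1q⟩, x, hx, rfl⟩ := hd.inter_open_nonempty
    ({z | ‖z‖ < 1} ×ˢ {z | 1 < ‖z‖})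
    ((isOpen_lt continuous_norm continuous_const).prod
      (isOpen_lt continuous_const continuous_norm))
    ⟨(0, (q : ℚ_[q])⁻¹), by simp, by
      simpa using (Fact.out : q.Prime).one_lt⟩
  simp only [Set.mem_ofPred_eq, Padic.eq_padicNorm] at h1p h1q
  have h := padicNorm_le_one_iff_of_mem_finiteCusps h0 h1 hup huq htp htq hx
  have hp : padicNorm p x ≤ 1 := by exact_mod_cast h1p.le
  exact absurd (h.1 hp) (not_le.2 (by exact_mod_cast h1q))
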